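/- For all real numbers x, y with x > 0 and y > 0, the relative pressure satisfies the upper bound P(x|y) ≤ (1/2)·max{1/x, 1/y}·(x − y)². -/

import Mathlib

open Real

/-- The relative pressure `P(x|y) = x log x - y log y + (y - x)(1 + log y)`. -/
noncomputable def relPressure (x y : ℝ) : ℝ :=
  x * Real.log x - y * Real.log y + (y - x) * (1 + Real.log y)

/-- For `x, y > 0`, `P(x|y) ≤ (1/2) max{1/x, 1/y} (x - y)^2`. -/
theorem relPressure_upper_bound (x y : ℝ) (hx : 0 < x) (hy : 0 < y) :
    relPressure x y ≤ (1 / 2) * max (1 / x) (1 / y) * (x - y) ^ 2 := by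
  have hP : relPressure x y = x * (Real.log x - Real.log y) + (y - x) := by
    unfold relPressure; ring
  rw [hP]
  rcases le_total y x with h | h
  · have h1 : max (1 / x) (1 / y) = 1 / y := max_eq_right (one_div_le_one_div_of_le hy h)
    rw [h1, ← Real.log_div hx.ne' hy.ne']
    have ht : 0 < x / y := div_pos hx hy
    have h2 : Real.log (x / y) ≤ Real.sinh (Real.log (x / y)) :=
      Real.self_le_sinh_iff.2 (Real.log_nonneg ((one_le_div hy).2 h))
    rw [Real.sinh_log ht] at h2
    calc x * Real.log (x / y) + (y - x)
        ≤ x * ((x / y - (x / y)⁻¹) / 2) + (y - x) := by gcongr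
      _ = 1 / 2 * (1 / y) * (x - y) ^ 2 := by
        field_simp
        ring
  · have h1 : max (1 / x) (1 / y) = 1 / x := max_eq_left (one_div_le_one_div_of_le hx h)
    have hu : 0 ≤ (y - x) / x := div_nonneg (by linarith) hx.le
    have h2 := Real.le_log_one_add_of_nonneg hu
    have h3 : 1 + (y - x) / x = y / x := by field_simp; ring
    rw [h3, Real.log_div hy.ne' hx.ne'] at h2
    have h4 : (y - x) / x - ((y - x) / x) ^ 2 / 2 ≤ 2 * ((y - x) / x) / ((y - x) / x + 2) := by
      rw [le_div_iff₀ (by linarith)]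
      nlinarith [pow_nonneg hu 3]
    have h5 := mul_le_mul_of_nonneg_left (h4.trans h2) hx.le
    have h6 : x * ((y - x) / x - ((y - x) / x) ^ 2 / 2)
        = (y - x) - 1 / 2 * (1 / x) * (x - y) ^ 2 := by
      field_simp
      ring
    rw [h1]
    linarith
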